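/- arXiv:2003.06712 — 2 statements merged into one kernel-verified Lean document; each statement's English description precedes it below -/
import Mathlib

section
/- Soundness of the Miller–Tucker–Zemlin subtour elimination constraints: let N ≥ 2 and let σ be a permutation of Fin N with no fixed points (σ(i) ≠ i for all i). Suppose there exists seq : Fin N → ℝ such that for all i, j ∈ Fin N with i ≠ j, i ≠ 0 and j ≠ 0, one has seq(i) − seq(j) + N·p_{ij} ≤ N − 1, where p_{ij} = 1 if σ(i) = j and p_{ij} = 0 otherwise. Then σ is a single N-cycle, i.e. σ is a cyclic permutation whose cycle contains every element of Fin N. -/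
/-- If a real potential increases by at least `1` along every step of `σ` between points
different from `a`, then the cycle of `σ` through any point contains `a`. -/
theorem Equiv.Perm.sameCycle_of_potential {α : Type*} [Finite α] (σ : Equiv.Perm α) (a : α)
    (f : α → ℝ) (hf : ∀ i, i ≠ a → σ i ≠ a → f i + 1 ≤ f (σ i)) (x : α) :
    σ.SameCycle a x := by
  by_contra h
  have hne (n : ℕ) : (σ ^ n) x ≠ a := fun hn =>
    h (Equiv.Perm.SameCycle.symm ⟨n, by simpa using hn⟩)
  have hstep (n : ℕ) : f x + n ≤ f ((σ ^ n) x) := by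
    induction n with
    | zero => simp
    | succ n ih =>
      have hs : (σ ^ (n + 1)) x = σ ((σ ^ n) x) := by rw [pow_succ', Equiv.Perm.mul_apply]
      have := hf _ (hne n) (hs ▸ hne (n + 1))
      rw [hs, Nat.cast_succ]
      linarith
  have hperiod := hstep (orderOf σ)
  rw [pow_orderOf_eq_one, Equiv.Perm.one_apply] at hperiod
  have hpos : (0 : ℝ) < orderOf σ := by exact_mod_cast orderOf_pos σ
  linarith

/-- soundness of the Miller–Tucker–Zemlin subtour elimination constraints.
If a fixed-point-free permutation `σ` of `Fin N` admits potentials `seq` satisfying the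
MTZ constraints `seq i - seq j + N·p i j ≤ N - 1` for all `i ≠ j` with `i, j ≠ 0`
(where `p i j = 1` if `σ i = j` and `0` otherwise), then `σ` is a single `N`-cycle. -/
theorem mtz_sound (N : ℕ) (hN : 2 ≤ N) (σ : Equiv.Perm (Fin N))
    (hfix : ∀ i, σ i ≠ i) (seq : Fin N → ℝ)
    (hmtz : ∀ i j : Fin N, i ≠ j → (i : ℕ) ≠ 0 → (j : ℕ) ≠ 0 →
      seq i - seq j + (N : ℝ) * (if σ i = j then (1 : ℝ) else 0) ≤ (N : ℝ) - 1) :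
    σ.IsCycle ∧ σ.support = Finset.univ := by
  have hsame := σ.sameCycle_of_potential ⟨0, by omega⟩ seq fun i hi hσi => by
    have := hmtz i (σ i) (hfix i).symm (fun h => hi (Fin.ext h)) (fun h => hσi (Fin.ext h))
    rw [if_pos rfl] at this
    linarith
  refine ⟨⟨⟨0, by omega⟩, hfix _, fun y _ => hsame y⟩, ?_⟩
  ext i
  simp [hfix i]
end

section
/- Completeness of the Miller–Tucker–Zemlin subtour elimination constraints: let N ≥ 2 and let σ be a permutation of Fin N that is a single N-cycle. Then there exists seq : Fin N → ℝ with 1 ≤ seq(i) ≤ N − 1 for all i ≠ 0, such that for all i, j ∈ Fin N with i ≠ j, i ≠ 0 and j ≠ 0, one has seq(i) − seq(j) + N·p_{ij} ≤ N − 1, where p_{ij} = 1 if σ(i) = j and p_{ij} = 0 otherwise. -/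
/-- completeness of the Miller–Tucker–Zemlin subtour elimination
constraints. If `σ` is a single `N`-cycle on `Fin N`, then there are potentials `seq`
with `1 ≤ seq i ≤ N - 1` for `i ≠ 0` satisfying all MTZ constraints
`seq i - seq j + N·p i j ≤ N - 1` for `i ≠ j`, `i, j ≠ 0`
(where `p i j = 1` if `σ i = j` and `0` otherwise). -/
theorem mtz_complete (N : ℕ) (hN : 2 ≤ N) (σ : Equiv.Perm (Fin N))
    (hσ : σ.IsCycle ∧ σ.support = Finset.univ) :
    ∃ seq : Fin N → ℝ,
      (∀ i : Fin N, (i : ℕ) ≠ 0 → 1 ≤ seq i ∧ seq i ≤ (N : ℝ) - 1) ∧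
      ∀ i j : Fin N, i ≠ j → (i : ℕ) ≠ 0 → (j : ℕ) ≠ 0 →
        seq i - seq j + (N : ℝ) * (if σ i = j then (1 : ℝ) else 0) ≤ (N : ℝ) - 1 := by
  obtain ⟨hcyc, hsupp⟩ := hσ
  have hon : σ.IsCycleOn ((Finset.univ : Finset (Fin N)) : Set (Fin N)) := by
    have h := hcyc.isCycleOn
    have hset : {x | σ x ≠ x} = ((Finset.univ : Finset (Fin N)) : Set (Fin N)) := by
      rw [← hsupp, Equiv.Perm.coe_support_eq_set_support]
    rwa [hset] at h
  let o : Fin N := ⟨0, by omega⟩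
  have hpow : ∀ i : Fin N, ∃ n < N, (σ ^ n) o = i := fun i => by
    simpa using hon.exists_pow_eq (Finset.mem_univ o) (Finset.mem_univ i)
  choose pos hlt hpos using hpow
  have hpos_one : ∀ i : Fin N, (i : ℕ) ≠ 0 → 1 ≤ pos i := by
    intro i hi
    by_contra! h
    have hio : i = o := by
      rw [← hpos i, Nat.lt_one_iff.mp h]
      rfl
    exact hi (congrArg Fin.val hio)
  have hsucc : ∀ i j : Fin N, (j : ℕ) ≠ 0 → σ i = j → pos j = pos i + 1 := by
    intro i j hj hij
    have h : (σ ^ (pos i + 1)) o = (σ ^ pos j) o := by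
      rw [pow_succ', Equiv.Perm.mul_apply, hpos, hpos, hij]
    have hmod := (hon.pow_apply_eq_pow_apply (Finset.mem_univ o)).mp h
    rw [Finset.card_univ, Fintype.card_fin, Nat.ModEq, Nat.mod_eq_of_lt (hlt j)] at hmod
    rcases (Nat.succ_le_of_lt (hlt i)).lt_or_eq with hi | hi
    · rw [← hmod, Nat.mod_eq_of_lt hi]
    · have := hpos_one j hj
      rw [show pos i + 1 = N from hi, Nat.mod_self] at hmod
      omega
  have hle : ∀ i : Fin N, (pos i : ℝ) + 1 ≤ N := fun i => by exact_mod_cast hlt i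
  have hge : ∀ i : Fin N, (i : ℕ) ≠ 0 → (1 : ℝ) ≤ pos i := fun i hi => by
    exact_mod_cast hpos_one i hi
  refine ⟨fun i => pos i, fun i hi => ⟨hge i hi, by linarith [hle i]⟩, ?_⟩
  intro i j _ _ hj
  split_ifs with hij
  · have h : (pos j : ℝ) = pos i + 1 := by exact_mod_cast hsucc i j hj hij
    linarith
  · linarith [hle i, hge j hj]
end
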